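/- Let n be a nonnegative integer and let q, a, c be nonzero complex numbers such that (q²;q²)_n ≠ 0, (a²q²;q²)_n ≠ 0, (c q^{-n};q²)_n ≠ 0, (c q^{-n+1};q²)_n ≠ 0, (−aq;q)_n ≠ 0, and (q/c;q)_n ≠ 0. Then ∑_{j=0}^{n} ((q^{-2n};q²)_j (c²;q²)_j (a;q²)_j (aq;q²)_j / ((q²;q²)_j (a²q²;q²)_j (c q^{-n};q²)_j (c q^{-n+1};q²)_j)) · q^{2j} = (−q;q)_n (aq/c;q)_n / ((−aq;q)_n (q/c;q)_n). -/

import Mathlib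

/-- The $q$-shifted factorial $(a;q)_m = \prod_{k=0}^{m-1}(1 - a q^k)$. -/
noncomputable def qPoch (q a : ℂ) (m : ℕ) : ℂ := ∏ k ∈ Finset.range m, (1 - a * q ^ k)

theorem qPoch_succ (q a : ℂ) (m : ℕ) : qPoch q a (m + 1) = qPoch q a m * (1 - a * q ^ m) :=
  Finset.prod_range_succ _ _

theorem qPoch_zero (q a : ℂ) : qPoch q a 0 = 1 := Finset.prod_range_zero _

theorem qPoch_mul_shift (q a : ℂ) (m : ℕ) :
    (1 - a) * qPoch q (a * q) m = qPoch q a m * (1 - a * q ^ m) := by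
  induction m with
  | zero => simp [qPoch_zero]
  | succ m ih =>
    rw [qPoch_succ, qPoch_succ, ← mul_assoc, ih]
    ring

theorem qPoch_ne_zero_iff {q a : ℂ} {m : ℕ} :
    qPoch q a m ≠ 0 ↔ ∀ k < m, 1 - a * q ^ k ≠ 0 := by
  simp [qPoch, Finset.prod_ne_zero_iff]

theorem qPoch_ne_zero_of_le {q a : ℂ} {m n : ℕ} (h : qPoch q a n ≠ 0) (hmn : m ≤ n) :
    qPoch q a m ≠ 0 :=
  qPoch_ne_zero_iff.2 fun k hk => qPoch_ne_zero_iff.1 h k (hk.trans_le hmn)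

theorem qPoch_eq_zero {q a : ℂ} {k m : ℕ} (hk : k < m) (h : a * q ^ k = 1) :
    qPoch q a m = 0 :=
  Finset.prod_eq_zero (Finset.mem_range.2 hk) (by simp [h])

/-- The summand of the quadratic ${}_4\phi_3$ series, with $e = q^{-2n}$ and $d = c q^{-n}$. -/
noncomputable def quadTerm (q a c e d : ℂ) (j : ℕ) : ℂ :=
  qPoch (q ^ 2) e j * qPoch (q ^ 2) (c ^ 2) j * qPoch (q ^ 2) a j * qPoch (q ^ 2) (a * q) j /
    (qPoch (q ^ 2) (q ^ 2) j * qPoch (q ^ 2) (a ^ 2 * q ^ 2) j * qPoch (q ^ 2) d j *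
      qPoch (q ^ 2) (d * q) j) * q ^ (2 * j)

theorem quadTerm_eq_zero {q a c e d : ℂ} {k j : ℕ} (hk : k < j) (h : e * (q ^ 2) ^ k = 1) :
    quadTerm q a c e d j = 0 := by
  simp [quadTerm, qPoch_eq_zero hk h]

theorem quadTerm_succ {q a c e d : ℂ} {j : ℕ}
    (h1 : qPoch (q ^ 2) (q ^ 2) (j + 1) ≠ 0) (h2 : qPoch (q ^ 2) (a ^ 2 * q ^ 2) (j + 1) ≠ 0)
    (h3 : qPoch (q ^ 2) d (j + 1) ≠ 0) (h4 : qPoch (q ^ 2) (d * q) (j + 1) ≠ 0) :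
    (1 - q ^ 2 * (q ^ 2) ^ j) * (1 - a ^ 2 * q ^ 2 * (q ^ 2) ^ j) * quadTerm q a c e d (j + 1) =
      q ^ 2 * ((1 - e * (q ^ 2) ^ j) * (1 - c ^ 2 * (q ^ 2) ^ j) * (1 - a * (q ^ 2) ^ j) *
        (1 - a * q * (q ^ 2) ^ j)) / ((1 - d * (q ^ 2) ^ j) * (1 - d * q * (q ^ 2) ^ j)) *
        quadTerm q a c e d j := by
  have e1 : q ^ (2 * (j + 1)) = q ^ 2 * (q ^ 2) ^ j := by rw [← pow_mul]; ring
  have e2 : q ^ (2 * j) = (q ^ 2) ^ j := pow_mul _ _ _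
  simp only [quadTerm, e1, e2]
  simp only [qPoch_succ, mul_ne_zero_iff] at *
  generalize (q ^ 2) ^ j = x at *
  obtain ⟨⟨h1, h1'⟩, ⟨h2, h2'⟩, ⟨h3, h3'⟩, h4, h4'⟩ := And.intro h1 (And.intro h2 (And.intro h3 h4))
  generalize 1 - q ^ 2 * x = y1 at *
  generalize 1 - a ^ 2 * q ^ 2 * x = y2 at *
  generalize 1 - d * x = y3 at *
  generalize 1 - d * q * x = y4 at *
  generalize qPoch (q ^ 2) (q ^ 2) j = z1 at *
  generalize qPoch (q ^ 2) (a ^ 2 * q ^ 2) j = z2 at *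
  generalize qPoch (q ^ 2) d j = z3 at *
  generalize qPoch (q ^ 2) (d * q) j = z4 at *
  field_simp

theorem quadTerm_shift {q a c e d : ℂ} {j : ℕ} (hd : 1 - d ≠ 0)
    (h3 : qPoch (q ^ 2) d (j + 1) ≠ 0) (h4 : qPoch (q ^ 2) (d * q) j ≠ 0) :
    (1 - e) / (1 - d) * quadTerm q a c (e * q ^ 2) (d * q) j =
      (1 - e * (q ^ 2) ^ j) / (1 - d * (q ^ 2) ^ j) * quadTerm q a c e d j := by
  have s1 := qPoch_mul_shift (q ^ 2) e j
  have s2 := qPoch_mul_shift (q ^ 2) d j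
  rw [qPoch_succ, mul_ne_zero_iff] at h3
  obtain ⟨h3, h3'⟩ := h3
  have e3 : d * q * q = d * q ^ 2 := by ring
  have s3 : qPoch (q ^ 2) (d * q ^ 2) j =
      qPoch (q ^ 2) d j * (1 - d * (q ^ 2) ^ j) / (1 - d) := by
    rw [eq_div_iff hd, ← s2]; ring
  simp only [quadTerm, e3, s3]
  calc _ = ((1 - e) * qPoch (q ^ 2) (e * q ^ 2) j) * (qPoch (q ^ 2) (c ^ 2) j *
        qPoch (q ^ 2) a j * qPoch (q ^ 2) (a * q) j /
        (qPoch (q ^ 2) (q ^ 2) j * qPoch (q ^ 2) (a ^ 2 * q ^ 2) j)) * q ^ (2 * j) /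
        (qPoch (q ^ 2) d j * (1 - d * (q ^ 2) ^ j) * qPoch (q ^ 2) (d * q) j) := by
        field_simp
    _ = _ := by rw [s1]; field_simp

/-- The recurrence of order two, at the level of summands: it telescopes. -/
theorem quadTerm_telescope {q a c e d : ℂ} {j : ℕ} (hq : q ≠ 0) (he : c ^ 2 * e = d ^ 2)
    (h1 : qPoch (q ^ 2) (q ^ 2) (j + 1) ≠ 0) (h2 : qPoch (q ^ 2) (a ^ 2 * q ^ 2) (j + 1) ≠ 0)
    (h3 : qPoch (q ^ 2) d (j + 1) ≠ 0) (h4 : qPoch (q ^ 2) (d * q) (j + 1) ≠ 0) :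
    q * (e - 1) * (e - a ^ 2) * quadTerm q a c e d j
      - (d - a) * (1 + q) * (e * q - a) *
        ((1 - e) / (1 - d) * quadTerm q a c (e * q ^ 2) (d * q) j)
      + (d * q - a) * (d - a) * ((1 - e) / (1 - d) *
        ((1 - e * q ^ 2) / (1 - d * q) * quadTerm q a c (e * q ^ 2 * q ^ 2) (d * q * q) j)) =
    e * q * (1 - (q ^ 2) ^ j) * (1 - a ^ 2 * (q ^ 2) ^ j) / (q ^ 2) ^ j * quadTerm q a c e d j
      - e * q * (1 - (q ^ 2) ^ (j + 1)) * (1 - a ^ 2 * (q ^ 2) ^ (j + 1)) / (q ^ 2) ^ (j + 1) *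
        quadTerm q a c e d (j + 1) := by
  have hd : 1 - d ≠ 0 := by simpa using qPoch_ne_zero_iff.1 h3 0 (by omega)
  have hdq : 1 - d * q ≠ 0 := by simpa using qPoch_ne_zero_iff.1 h4 0 (by omega)
  have hx : (q ^ 2) ^ j ≠ 0 := by positivity
  have hdx := qPoch_ne_zero_iff.1 h3 j (by omega)
  have hdqx := qPoch_ne_zero_iff.1 h4 j (by omega)
  have e3 : d * q * q = d * q ^ 2 := by ring
  have h5 : qPoch (q ^ 2) (d * q * q) j ≠ 0 := by
    have := qPoch_mul_shift (q ^ 2) d j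
    rw [← qPoch_succ] at this
    rw [e3]
    exact right_ne_zero_of_mul (this ▸ h3)
  have t0 := quadTerm_shift (a := a) (c := c) (e := e * q ^ 2) hdq h4 h5
  have t1 := quadTerm_shift (a := a) (c := c) (e := e) hd h3 (qPoch_ne_zero_of_le h4 j.le_succ)
  have t2 := quadTerm_succ (c := c) (e := e) h1 h2 h3 h4
  rw [t0, mul_left_comm ((1 - e) / (1 - d)), t1]
  have t3 : e * q * (1 - (q ^ 2) ^ (j + 1)) * (1 - a ^ 2 * (q ^ 2) ^ (j + 1)) /
      (q ^ 2) ^ (j + 1) * quadTerm q a c e d (j + 1) =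
      e * q / (q ^ 2 * (q ^ 2) ^ j) * ((1 - q ^ 2 * (q ^ 2) ^ j) *
        (1 - a ^ 2 * q ^ 2 * (q ^ 2) ^ j) * quadTerm q a c e d (j + 1)) := by
    rw [pow_succ (q ^ 2) j]; field_simp
  rw [t3, t2]
  clear t0 t1 t2 t3 h1 h2 h3 h4 h5
  generalize quadTerm q a c e d j = T
  generalize (q ^ 2) ^ j = x at *
  generalize hu : 1 - d * x = u at *
  generalize hv : 1 - d * q * x = v at *
  field_simp
  subst hu hv
  linear_combination -(T * x * q * (1 - e * x) * (1 - a * x) * (1 - a * q * x)) * he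

/-- Three-term recurrence in the length of the series. -/
theorem sum_quadTerm_recurrence {q a c e d : ℂ} {n : ℕ} (hq : q ≠ 0) (he : c ^ 2 * e = d ^ 2)
    (hen : e * (q ^ 2) ^ (n + 2) = 1)
    (h1 : qPoch (q ^ 2) (q ^ 2) (n + 2) ≠ 0) (h2 : qPoch (q ^ 2) (a ^ 2 * q ^ 2) (n + 2) ≠ 0)
    (h3 : qPoch (q ^ 2) d (n + 2) ≠ 0) (h4 : qPoch (q ^ 2) (d * q) (n + 2) ≠ 0) :
    q * (e - 1) * (e - a ^ 2) * ∑ j ∈ Finset.range (n + 3), quadTerm q a c e d j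
      - (d - a) * (1 + q) * (e * q - a) * ((1 - e) / (1 - d) *
        ∑ j ∈ Finset.range (n + 2), quadTerm q a c (e * q ^ 2) (d * q) j)
      + (d * q - a) * (d - a) * ((1 - e) / (1 - d) * ((1 - e * q ^ 2) / (1 - d * q) *
        ∑ j ∈ Finset.range (n + 1), quadTerm q a c (e * q ^ 2 * q ^ 2) (d * q * q) j)) = 0 := by
  have z : quadTerm q a c (e * q ^ 2 * q ^ 2) (d * q * q) (n + 1) = 0 :=
    quadTerm_eq_zero n.lt_succ_self (by rw [← hen]; ring)
  have s0 : ∑ j ∈ Finset.range (n + 1), quadTerm q a c (e * q ^ 2 * q ^ 2) (d * q * q) j =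
      ∑ j ∈ Finset.range (n + 2), quadTerm q a c (e * q ^ 2 * q ^ 2) (d * q * q) j := by
    rw [Finset.sum_range_succ _ (n + 1), z, add_zero]
  have tel := Finset.sum_range_sub' (fun j => e * q * (1 - (q ^ 2) ^ j) *
    (1 - a ^ 2 * (q ^ 2) ^ j) / (q ^ 2) ^ j * quadTerm q a c e d j) (n + 2)
  rw [← Finset.sum_congr rfl fun j hj => quadTerm_telescope hq he
    (qPoch_ne_zero_of_le h1 (Finset.mem_range.1 hj))
    (qPoch_ne_zero_of_le h2 (Finset.mem_range.1 hj))
    (qPoch_ne_zero_of_le h3 (Finset.mem_range.1 hj))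
    (qPoch_ne_zero_of_le h4 (Finset.mem_range.1 hj))] at tel
  simp only [Finset.sum_add_distrib, Finset.sum_sub_distrib, ← Finset.mul_sum] at tel
  have hx : (q ^ 2) ^ (n + 2) ≠ 0 := by positivity
  have hex : e = 1 / (q ^ 2) ^ (n + 2) := eq_div_of_mul_eq hx hen
  have top : q * (e - 1) * (e - a ^ 2) = e * q * (1 - (q ^ 2) ^ (n + 2)) *
      (1 - a ^ 2 * (q ^ 2) ^ (n + 2)) / (q ^ 2) ^ (n + 2) := by
    generalize (q ^ 2) ^ (n + 2) = x at *
    subst hex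
    field_simp
  rw [s0, Finset.sum_range_succ _ (n + 2), mul_add]
  rw [← top] at tel
  linear_combination tel

/-- The closed form of the series satisfies the same recurrence. -/
theorem closedForm_recurrence {q a d e p : ℂ} (hq : q ≠ 0) (hp : p ≠ 0) (hd : d ≠ 0)
    (hen : e * (q ^ 2 * p) ^ 2 = 1) (h1 : 1 - d ≠ 0) (h2 : 1 - d * q ≠ 0)
    (h3 : 1 + a * q * p ≠ 0) (h4 : 1 + a * q * (p * q) ≠ 0) :
    q * (e - 1) * (e - a ^ 2) * ((1 + q * p) * (1 - a / (d * q)) * (1 + q * (p * q)) * (1 - a / d)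
        / ((1 + a * q * p) * (1 - 1 / (d * q)) * (1 + a * q * (p * q)) * (1 - 1 / d)))
      - (d - a) * (1 + q) * (e * q - a) * ((1 - e) / (1 - d) *
        ((1 + q * p) * (1 - a / (d * q)) / ((1 + a * q * p) * (1 - 1 / (d * q)))))
      + (d * q - a) * (d - a) * ((1 - e) / (1 - d) * ((1 - e * q ^ 2) / (1 - d * q))) = 0 := by
  have hex : e = 1 / (q ^ 2 * p) ^ 2 := eq_div_of_mul_eq (by positivity) hen
  have r1 : 1 - a / (d * q) = (d * q - a) / (d * q) := by field_simp
  have r2 : 1 - a / d = (d - a) / d := by field_simp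
  have r3 : 1 - 1 / (d * q) = -(1 - d * q) / (d * q) := by field_simp; ring
  have r4 : 1 - 1 / d = -(1 - d) / d := by field_simp; ring
  rw [r1, r2, r3, r4]
  generalize hu : 1 - d = u at *
  generalize hv : 1 - d * q = v at *
  generalize hs : 1 + a * q * p = s at *
  generalize ht : 1 + a * q * (p * q) = t at *
  subst hex
  clear r1 r2 r3 r4
  field_simp
  subst hu hv hs ht
  ring

theorem qPoch_shift_ne_zero {q d : ℂ} {n : ℕ} (h : qPoch q d (n + 1) ≠ 0) :
    qPoch q (d * q) n ≠ 0 := by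
  have := qPoch_mul_shift q d n
  rw [← qPoch_succ] at this
  exact right_ne_zero_of_mul (this ▸ h)

theorem sum_quadTerm {q a c e d : ℂ} {n : ℕ} (hq : q ≠ 0) (hc : c ≠ 0)
    (he : e * (q ^ n) ^ 2 = 1) (hd : d * q ^ n = c)
    (h1 : qPoch (q ^ 2) (q ^ 2) n ≠ 0) (h2 : qPoch (q ^ 2) (a ^ 2 * q ^ 2) n ≠ 0)
    (h3 : qPoch (q ^ 2) d n ≠ 0) (h4 : qPoch (q ^ 2) (d * q) n ≠ 0)
    (h5 : qPoch q (-(a * q)) n ≠ 0) :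
    ∑ j ∈ Finset.range (n + 1), quadTerm q a c e d j =
      qPoch q (-q) n * qPoch q (a * q / c) n / (qPoch q (-(a * q)) n * qPoch q (q / c) n) := by
  have hd0 : d ≠ 0 := left_ne_zero_of_mul (hd ▸ hc)
  induction n using Nat.twoStepInduction generalizing d e with
  | zero => simp [quadTerm, qPoch_zero]
  | one =>
    simp only [pow_one] at he hd
    have hex : e = 1 / q ^ 2 := eq_div_of_mul_eq (by positivity) he
    subst hex hd
    simp only [qPoch_succ, qPoch_zero, pow_zero, mul_one, one_mul, ne_eq] at h1 h2 h3 h4 h5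
    have f1 : 1 + a * q ≠ 0 := fun h => h5 (by linear_combination h)
    have f2 : 1 - a * q ≠ 0 := fun h => h2 (by linear_combination (1 + a * q) * h)
    have f3 : 1 - 1 / d = -(1 - d) / d := by field_simp; ring
    have f4 : 1 - q / (d * q) = -(1 - d) / d := by field_simp; ring
    have f5 : 1 - a ^ 2 * q ^ 2 = (1 + a * q) * (1 - a * q) := by ring
    have f6 : 1 - 1 / q ^ 2 = -(1 - q ^ 2) / q ^ 2 := by field_simp; ring
    have f7 : 1 - -(a * q) = 1 + a * q := by ring
    simp only [Finset.sum_range_succ, Finset.sum_range_zero, quadTerm, qPoch_succ, qPoch_zero,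
      zero_add, pow_zero, mul_one, one_mul, div_one, f4, f5, f6, f7]
    clear f3 f4 f5 f6 f7 h5 h2
    generalize hu : 1 - d = u at *
    generalize hv : 1 - d * q = v at *
    generalize hs : 1 + a * q = s at *
    generalize ht : 1 - a * q = t at *
    generalize 1 - q ^ 2 = w at *
    field_simp
    subst hu hv hs ht
    ring
  | more n ih0 ih1 =>
    have hp : q ^ n ≠ 0 := pow_ne_zero _ hq
    have h4' := qPoch_ne_zero_of_le h4 (Nat.le_succ (n + 1))
    have h3' : qPoch (q ^ 2) (d * q * q) (n + 1) ≠ 0 := by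
      rw [mul_assoc, ← sq]; exact qPoch_shift_ne_zero h3
    have h4'' : qPoch (q ^ 2) (d * q * q * q) n ≠ 0 := by
      rw [mul_assoc (d * q), ← sq]; exact qPoch_shift_ne_zero h4'
    have i1 := ih1 (e := e * q ^ 2) (d := d * q) (by rw [← he]; ring) (by rw [← hd]; ring)
      (qPoch_ne_zero_of_le h1 (by omega)) (qPoch_ne_zero_of_le h2 (by omega)) h4' h3'
      (qPoch_ne_zero_of_le h5 (by omega)) (mul_ne_zero hd0 hq)
    have i0 := ih0 (e := e * q ^ 2 * q ^ 2) (d := d * q * q) (by rw [← he]; ring)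
      (by rw [← hd]; ring)
      (qPoch_ne_zero_of_le h1 (by omega)) (qPoch_ne_zero_of_le h2 (by omega))
      (qPoch_ne_zero_of_le h3' (by omega)) h4''
      (qPoch_ne_zero_of_le h5 (by omega)) (mul_ne_zero (mul_ne_zero hd0 hq) hq)
    have hec : c ^ 2 * e = d ^ 2 := by rw [← hd]; linear_combination d ^ 2 * he
    have hen : e * (q ^ 2) ^ (n + 2) = 1 := by rw [← he]; ring
    have hrec := sum_quadTerm_recurrence hq hec hen h1 h2 h3 h4
    have g1 : 1 - d ≠ 0 := by simpa using qPoch_ne_zero_iff.1 h3 0 (by omega)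
    have g2 : 1 - d * q ≠ 0 := by simpa using qPoch_ne_zero_iff.1 h4 0 (by omega)
    have g3 : 1 + a * q * q ^ n ≠ 0 := by simpa using qPoch_ne_zero_iff.1 h5 n (by omega)
    have g4 : 1 + a * q * (q ^ n * q) ≠ 0 := by
      simpa [pow_succ] using qPoch_ne_zero_iff.1 h5 (n + 1) (by omega)
    have cf := closedForm_recurrence (e := e) hq hp hd0 (by rw [← he]; ring) g1 g2 g3 g4
    have hb1 := qPoch_ne_zero_iff.1 h1 (n + 1) (by omega)
    have hb2 := qPoch_ne_zero_iff.1 h2 (n + 1) (by omega)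
    have k1 : e - 1 ≠ 0 := fun h => hb1 (by
      linear_combination -hen + (q ^ 2) ^ (n + 2) * h)
    have k2 : e - a ^ 2 ≠ 0 := fun h => hb2 (by
      linear_combination -hen + (q ^ 2) ^ (n + 2) * h)
    have c1 : ∀ z, z * q / c * q ^ n = z / (d * q) := fun z => by rw [← hd, pow_add]; field_simp
    have c2 : ∀ z, z * q / c * (q ^ n * q) = z / d := fun z => by rw [← hd, pow_add]; field_simp
    have c3 : q / c * q ^ n = 1 / (d * q) := by simpa using c1 1
    have c4 : q / c * (q ^ n * q) = 1 / d := by simpa using c2 1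
    rw [i0, i1] at hrec
    simp only [qPoch_succ _ _ n, qPoch_succ _ _ (n + 1)] at hrec ⊢
    rw [c1, c3] at hrec ⊢
    rw [pow_succ q n, c2, c4]
    have c5 : ∀ y z : ℂ, 1 - -y * z = 1 + y * z := fun y z => by ring
    rw [c5 q, c5 (a * q)] at hrec
    rw [c5 q, c5 q, c5 (a * q), c5 (a * q)]
    refine mul_left_cancel₀ (mul_ne_zero (mul_ne_zero hq k1) k2) ?_
    clear ih0 ih1 i0 i1 c1 c2 c3 c4 c5 k1 k2
    generalize ∑ j ∈ Finset.range (n + 3), quadTerm q a c e d j = S at *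
    generalize 1 + q * q ^ n = x1 at *
    generalize 1 + q * (q ^ n * q) = x2 at *
    generalize 1 + a * q * q ^ n = x3 at *
    generalize 1 + a * q * (q ^ n * q) = x4 at *
    generalize 1 - a / (d * q) = x5 at *
    generalize 1 - a / d = x6 at *
    generalize 1 - 1 / (d * q) = x7 at *
    generalize 1 - 1 / d = x8 at *
    generalize (1 - e) / (1 - d) = y1 at *
    generalize (1 - e * q ^ 2) / (1 - d * q) = y2 at *
    generalize q * (e - 1) * (e - a ^ 2) = l2 at *
    generalize (d - a) * (1 + q) * (e * q - a) = l1 at *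
    generalize (d * q - a) * (d - a) = l0 at *
    linear_combination hrec -
      qPoch q (-q) n * qPoch q (a * q / c) n / (qPoch q (-(a * q)) n * qPoch q (q / c) n) * cf

/-- Gasper–Rahman Ex. 3.34: a quadratic-base ${}_4\phi_3$ summation. -/
theorem quadratic_4phi3 (n : ℕ) (q a c : ℂ) (hq : q ≠ 0) (ha : a ≠ 0) (hc : c ≠ 0)
    (h1 : qPoch (q ^ 2) (q ^ 2) n ≠ 0) (h2 : qPoch (q ^ 2) (a ^ 2 * q ^ 2) n ≠ 0)
    (h3 : qPoch (q ^ 2) (c * q ^ (-(n : ℤ))) n ≠ 0)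
    (h4 : qPoch (q ^ 2) (c * q ^ (1 - (n : ℤ))) n ≠ 0)
    (h5 : qPoch q (-(a * q)) n ≠ 0) (h6 : qPoch q (q / c) n ≠ 0) :
    ∑ j ∈ Finset.range (n + 1),
      qPoch (q ^ 2) (q ^ (-(2 * (n : ℤ)))) j * qPoch (q ^ 2) (c ^ 2) j *
        qPoch (q ^ 2) a j * qPoch (q ^ 2) (a * q) j /
        (qPoch (q ^ 2) (q ^ 2) j * qPoch (q ^ 2) (a ^ 2 * q ^ 2) j *
          qPoch (q ^ 2) (c * q ^ (-(n : ℤ))) j * qPoch (q ^ 2) (c * q ^ (1 - (n : ℤ))) j) *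
        q ^ (2 * j)
    = qPoch q (-q) n * qPoch q (a * q / c) n / (qPoch q (-(a * q)) n * qPoch q (q / c) n) := by
  have hd : c * q ^ (1 - (n : ℤ)) = c * q ^ (-(n : ℤ)) * q := by
    rw [mul_assoc, ← zpow_add_one₀ hq]; ring_nf
  rw [hd] at h4 ⊢
  refine sum_quadTerm hq hc ?_ ?_ h1 h2 h3 h4 h5
  · rw [← pow_mul, ← zpow_natCast, ← zpow_add₀ hq]
    simp [mul_comm]
  · rw [zpow_neg, zpow_natCast]
    field_simp
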